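/- arXiv:math/0609676 — 2 statements merged into one kernel-verified Lean document; each statement's English description precedes it below -/
import Mathlib

section
/- Let h be a faithful Haar state on A, let u ∈ M_d(A) be an irreducible unitary corepresentation, and let C := span_ℂ{star(u_{ij}) : 1 ≤ i, j ≤ d}. Let L ⊆ End_ℂ(C) be the algebra of restrictions to C of the maps a ↦ (φ ⊗ id)(Δ a), φ ranging over all linear functionals on A. Then the commutant of L in End_ℂ(C) equals the algebra of restrictions to C of the maps a ↦ (id ⊗ ψ)(Δ a), ψ ranging over all linear functionals on A, and this commutant is isomorphic as a ℂ-algebra to the full matrix algebra M_d(ℂ). -/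
open scoped TensorProduct BigOperators ComplexOrder

/-- Apply a functional to the first tensor factor of the comultiplication: `a ↦ (φ ⊗ id)(Δ a)`. -/
noncomputable def applyFst {A : Type*} [Ring A] [Bialgebra ℂ A] (φ : A →ₗ[ℂ] ℂ) : A →ₗ[ℂ] A :=
  (TensorProduct.lid ℂ A).toLinearMap ∘ₗ LinearMap.rTensor A φ ∘ₗ Coalgebra.comul

/-- Apply a functional to the second tensor factor of the comultiplication: `a ↦ (id ⊗ φ)(Δ a)`. -/
noncomputable def applySnd {A : Type*} [Ring A] [Bialgebra ℂ A] (φ : A →ₗ[ℂ] ℂ) : A →ₗ[ℂ] A :=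
  (TensorProduct.rid ℂ A).toLinearMap ∘ₗ LinearMap.lTensor A φ ∘ₗ Coalgebra.comul

/-- `h` is a Haar state: normalized, right- and left-invariant, and positive. -/
def IsHaarState {A : Type*} [Ring A] [StarRing A] [Bialgebra ℂ A] (h : A →ₗ[ℂ] ℂ) : Prop :=
  h 1 = 1 ∧ (∀ a : A, applySnd h a = h a • (1 : A)) ∧ (∀ a : A, applyFst h a = h a • (1 : A)) ∧
    ∀ a : A, 0 ≤ h (star a * a)

/-- The comultiplication is a `*`-homomorphism: if `Δ x = Σ aᵢ ⊗ bᵢ` then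
`Δ (star x) = Σ star aᵢ ⊗ star bᵢ`. -/
def ComulStar (A : Type*) [Ring A] [StarRing A] [Bialgebra ℂ A] : Prop :=
  ∀ (x : A) (n : ℕ) (a b : Fin n → A),
    Coalgebra.comul (R := ℂ) x = ∑ i, a i ⊗ₜ[ℂ] b i →
      Coalgebra.comul (R := ℂ) (star x) = ∑ i, star (a i) ⊗ₜ[ℂ] star (b i)

/-- `u` is a corepresentation matrix: `Δ(uᵢⱼ) = Σₖ uᵢₖ ⊗ uₖⱼ` and `ε(uᵢⱼ) = δᵢⱼ`. -/
def IsCorep {A : Type*} [Ring A] [Bialgebra ℂ A] {d : ℕ} (u : Matrix (Fin d) (Fin d) A) : Prop :=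
  (∀ i j, Coalgebra.comul (R := ℂ) (u i j) = ∑ k, u i k ⊗ₜ[ℂ] u k j) ∧
    ∀ i j, Coalgebra.counit (R := ℂ) (u i j) = if i = j then 1 else 0

/-- `u` is a unitary matrix over the `*`-algebra `A`. -/
def IsUnitaryMatrix {A : Type*} [Ring A] [StarRing A] {d : ℕ}
    (u : Matrix (Fin d) (Fin d) A) : Prop :=
  (∀ i j, ∑ k, u i k * star (u j k) = if i = j then (1 : A) else 0) ∧
    ∀ i j, ∑ k, star (u k i) * u k j = if i = j then (1 : A) else 0

/-- The scalar matrix `T` intertwines the corepresentations `u` and `v`. -/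
def Intertwines {A : Type*} [Ring A] [Algebra ℂ A] {m n : ℕ}
    (u : Matrix (Fin m) (Fin m) A) (v : Matrix (Fin n) (Fin n) A)
    (T : Matrix (Fin m) (Fin n) ℂ) : Prop :=
  ∀ i j, ∑ k, T k j • u i k = ∑ k, T i k • v k j

/-- A corepresentation is irreducible if its only self-intertwiners are scalar multiples of the
identity. -/
def IsIrreducibleCorep {A : Type*} [Ring A] [Algebra ℂ A] {d : ℕ}
    (u : Matrix (Fin d) (Fin d) A) : Prop :=
  ∀ T : Matrix (Fin d) (Fin d) ℂ, Intertwines u u T →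
    ∃ c : ℂ, T = c • (1 : Matrix (Fin d) (Fin d) ℂ)

open Module in
/-- The endomorphism `b (i, j) ↦ ∑ k, M i k • b (k, j)`. -/
noncomputable def leftMatrixEnd {V : Type*} [AddCommGroup V] [Module ℂ V] {d : ℕ}
    (b : Basis (Fin d × Fin d) ℂ V) (M : Matrix (Fin d) (Fin d) ℂ) : Module.End ℂ V :=
  b.constr ℂ fun p => ∑ k, M p.1 k • b (k, p.2)

open Module in
/-- The endomorphism `b (i, j) ↦ ∑ k, N k j • b (i, k)`. -/
noncomputable def rightMatrixEnd {V : Type*} [AddCommGroup V] [Module ℂ V] {d : ℕ}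
    (b : Basis (Fin d × Fin d) ℂ V) (N : Matrix (Fin d) (Fin d) ℂ) : Module.End ℂ V :=
  b.constr ℂ fun p => ∑ k, N k p.2 • b (p.1, k)

section MatrixEnd

variable {V : Type*} [AddCommGroup V] [Module ℂ V] {d : ℕ}
  (b : Module.Basis (Fin d × Fin d) ℂ V)

theorem leftMatrixEnd_basis (M : Matrix (Fin d) (Fin d) ℂ) (i j : Fin d) :
    leftMatrixEnd b M (b (i, j)) = ∑ k, M i k • b (k, j) := by
  simp [leftMatrixEnd]

theorem rightMatrixEnd_basis (N : Matrix (Fin d) (Fin d) ℂ) (i j : Fin d) :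
    rightMatrixEnd b N (b (i, j)) = ∑ k, N k j • b (i, k) := by
  simp [rightMatrixEnd]

theorem leftMatrixEnd_mul_rightMatrixEnd (M N : Matrix (Fin d) (Fin d) ℂ) :
    leftMatrixEnd b M * rightMatrixEnd b N = rightMatrixEnd b N * leftMatrixEnd b M := by
  refine b.ext fun ⟨i, j⟩ => ?_
  simp only [Module.End.mul_apply, leftMatrixEnd_basis, rightMatrixEnd_basis, map_sum, map_smul,
    Finset.smul_sum]
  rw [Finset.sum_comm]
  exact Finset.sum_congr rfl fun _ _ => Finset.sum_congr rfl fun _ _ => smul_comm _ _ _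

theorem exists_eq_rightMatrixEnd (f : Module.End ℂ V)
    (hf : ∀ M, leftMatrixEnd b M * f = f * leftMatrixEnd b M) :
    ∃ N, f = rightMatrixEnd b N := by
  refine ⟨Matrix.of fun q j => b.repr (f (b (j, j))) (j, q), b.ext fun ⟨i, j⟩ => ?_⟩
  have key := LinearMap.congr_fun (hf (Matrix.single j i 1)) (b (j, j))
  simp only [Module.End.mul_apply, leftMatrixEnd_basis, Matrix.single_apply, ite_smul,
    true_and, one_smul, zero_smul, Finset.sum_ite_eq, Finset.mem_univ, if_true] at key
  rw [← key, rightMatrixEnd_basis]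
  conv_lhs => rw [← b.sum_repr (f (b (j, j)))]
  simp only [map_sum, map_smul, Fintype.sum_prod_type, leftMatrixEnd_basis, Matrix.single_apply,
    ite_smul, one_smul, zero_smul]
  rw [Finset.sum_eq_single j]
  · simp
  · intro p _ hp
    simp [Ne.symm hp]
  · simp

/-- `rightMatrixEnd` as an algebra homomorphism. -/
noncomputable def rightMatrixEndHom : Matrix (Fin d) (Fin d) ℂ →ₐ[ℂ] Module.End ℂ V :=
  AlgHom.ofLinearMap
    { toFun := rightMatrixEnd b
      map_add' := fun M N => b.ext fun ⟨i, j⟩ => by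
        simp [rightMatrixEnd_basis, add_smul, Finset.sum_add_distrib]
      map_smul' := fun c M => b.ext fun ⟨i, j⟩ => by
        simp [rightMatrixEnd_basis, mul_smul, Finset.smul_sum] }
    (b.ext fun ⟨i, j⟩ => by simp [rightMatrixEnd_basis, Matrix.one_apply])
    (fun M N => b.ext fun ⟨i, j⟩ => by
      simp only [LinearMap.coe_mk, AddHom.coe_mk, Module.End.mul_apply, rightMatrixEnd_basis,
        Matrix.mul_apply, map_sum, map_smul, Finset.smul_sum, Finset.sum_smul, smul_smul]
      rw [Finset.sum_comm]
      exact Finset.sum_congr rfl fun _ _ => Finset.sum_congr rfl fun _ _ => by rw [mul_comm])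

theorem rightMatrixEndHom_apply (N : Matrix (Fin d) (Fin d) ℂ) :
    rightMatrixEndHom b N = rightMatrixEnd b N := rfl

theorem rightMatrixEndHom_injective : Function.Injective (rightMatrixEndHom b) := by
  rw [injective_iff_map_eq_zero]
  intro N hN
  ext i j
  have key := congrArg (fun x => b.repr x (i, i)) (LinearMap.congr_fun hN (b (i, j)))
  simpa [rightMatrixEndHom_apply, rightMatrixEnd_basis, Finsupp.single_apply] using key

theorem centralizer_range_leftMatrixEnd :
    Subalgebra.centralizer ℂ (Set.range (leftMatrixEnd b)) = (rightMatrixEndHom b).range := by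
  ext f
  rw [Subalgebra.mem_centralizer_iff, AlgHom.mem_range]
  constructor
  · intro hf
    obtain ⟨N, rfl⟩ := exists_eq_rightMatrixEnd b f fun M => hf _ ⟨M, rfl⟩
    exact ⟨N, rfl⟩
  · rintro ⟨N, rfl⟩ _ ⟨M, rfl⟩
    exact leftMatrixEnd_mul_rightMatrixEnd b M N

end MatrixEnd

theorem LinearIndependent.exists_functional_eq {ι A : Type*} [AddCommGroup A] [Module ℂ A]
    {v : ι → A} (hv : LinearIndependent ℂ v) (c : ι → ℂ) : ∃ φ : A →ₗ[ℂ] ℂ, ∀ i, φ (v i) = c i := by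
  obtain ⟨φ, hφ⟩ := LinearMap.exists_extend ((Module.Basis.span hv).constr ℂ c)
  refine ⟨φ, fun i => ?_⟩
  have key := LinearMap.congr_fun hφ (Module.Basis.span hv i)
  rw [Module.Basis.constr_basis] at key
  simpa [Module.Basis.span_apply] using key

section Slices

variable {A : Type*} [Ring A] [Bialgebra ℂ A]

theorem applyFst_of_comul_eq_sum {ι : Type*} {s : Finset ι} {x : A} {a b : ι → A}
    (hx : Coalgebra.comul (R := ℂ) x = ∑ i ∈ s, a i ⊗ₜ[ℂ] b i) (φ : A →ₗ[ℂ] ℂ) :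
    applyFst φ x = ∑ i ∈ s, φ (a i) • b i := by
  simp [applyFst, hx]

theorem applySnd_of_comul_eq_sum {ι : Type*} {s : Finset ι} {x : A} {a b : ι → A}
    (hx : Coalgebra.comul (R := ℂ) x = ∑ i ∈ s, a i ⊗ₜ[ℂ] b i) (φ : A →ₗ[ℂ] ℂ) :
    applySnd φ x = ∑ i ∈ s, φ (b i) • a i := by
  simp [applySnd, hx]

variable {d : ℕ} {v : Fin d × Fin d → A} {C : Submodule ℂ A}
  (b : Module.Basis (Fin d × Fin d) ℂ C)

theorem setOf_restrict_applyFst (hb : ∀ p, (b p : A) = v p) (hv : LinearIndependent ℂ v)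
    (hΔ : ∀ i j, Coalgebra.comul (R := ℂ) (v (i, j)) = ∑ k, v (i, k) ⊗ₜ[ℂ] v (k, j)) :
    {f : Module.End ℂ C | ∃ φ : A →ₗ[ℂ] ℂ, ∀ x : C, (f x : A) = applyFst φ x} =
      Set.range (leftMatrixEnd b) := by
  have key : ∀ (φ : A →ₗ[ℂ] ℂ) (x : C),
      (leftMatrixEnd b (Matrix.of fun i j => φ (v (i, j))) x : A) = applyFst φ x := by
    intro φ x
    have : C.subtype ∘ₗ leftMatrixEnd b (Matrix.of fun i j => φ (v (i, j))) = applyFst φ ∘ₗ C.subtype :=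
      b.ext fun ⟨i, j⟩ => by
        simp [leftMatrixEnd_basis, hb, applyFst_of_comul_eq_sum (hΔ i j)]
    exact LinearMap.congr_fun this x
  ext f
  constructor
  · rintro ⟨φ, hφ⟩
    exact ⟨_, LinearMap.ext fun x => Subtype.ext ((key φ x).trans (hφ x).symm)⟩
  · rintro ⟨M, rfl⟩
    obtain ⟨φ, hφ⟩ := hv.exists_functional_eq fun p => M p.1 p.2
    refine ⟨φ, fun x => ?_⟩
    rw [← key]
    simp only [hφ]
    rfl

theorem setOf_restrict_applySnd (hb : ∀ p, (b p : A) = v p) (hv : LinearIndependent ℂ v)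
    (hΔ : ∀ i j, Coalgebra.comul (R := ℂ) (v (i, j)) = ∑ k, v (i, k) ⊗ₜ[ℂ] v (k, j)) :
    {f : Module.End ℂ C | ∃ ψ : A →ₗ[ℂ] ℂ, ∀ x : C, (f x : A) = applySnd ψ x} =
      Set.range (rightMatrixEnd b) := by
  have key : ∀ (ψ : A →ₗ[ℂ] ℂ) (x : C),
      (rightMatrixEnd b (Matrix.of fun i j => ψ (v (i, j))) x : A) = applySnd ψ x := by
    intro ψ x
    have : C.subtype ∘ₗ rightMatrixEnd b (Matrix.of fun i j => ψ (v (i, j))) = applySnd ψ ∘ₗ C.subtype :=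
      b.ext fun ⟨i, j⟩ => by
        simp [rightMatrixEnd_basis, hb, applySnd_of_comul_eq_sum (hΔ i j)]
    exact LinearMap.congr_fun this x
  ext f
  constructor
  · rintro ⟨ψ, hψ⟩
    exact ⟨_, LinearMap.ext fun x => Subtype.ext ((key ψ x).trans (hψ x).symm)⟩
  · rintro ⟨N, rfl⟩
    obtain ⟨ψ, hψ⟩ := hv.exists_functional_eq fun p => N p.1 p.2
    refine ⟨ψ, fun x => ?_⟩
    rw [← key]
    simp only [hψ]
    rfl

end Slices

section Orthogonality

variable {A : Type*} [Ring A] [StarRing A] [Bialgebra ℂ A] {d : ℕ}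
  {u : Matrix (Fin d) (Fin d) A}

theorem IsCorep.comul_star (hu : IsCorep u) (hstar : ComulStar A) (i j : Fin d) :
    Coalgebra.comul (R := ℂ) (star (u i j)) = ∑ k, star (u i k) ⊗ₜ[ℂ] star (u k j) :=
  hstar _ _ _ _ (hu.1 i j)

/-- Averaging `u · E_{kl} · u*` against a right-invariant functional gives a self-intertwiner. -/
theorem intertwines_haar (hstar : ComulStar A) {h : A →ₗ[ℂ] ℂ}
    (hinv : ∀ a : A, applySnd h a = h a • (1 : A)) (hu : IsCorep u) (huU : IsUnitaryMatrix u)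
    (k l : Fin d) : Intertwines u u fun i j => h (u i k * star (u j l)) := by
  have hΔ : ∀ i j, Coalgebra.comul (R := ℂ) (u i k * star (u j l)) =
      ∑ p : Fin d × Fin d, (u i p.1 * star (u j p.2)) ⊗ₜ[ℂ] (u p.1 k * star (u p.2 l)) := by
    intro i j
    rw [Bialgebra.comul_mul, hu.1, hu.comul_star hstar, Finset.sum_mul_sum,
      Fintype.sum_prod_type]
    simp only [Algebra.TensorProduct.tmul_mul_tmul]
  have hY : ∀ i j, ∑ m, ∑ n, h (u m k * star (u n l)) • (u i m * star (u j n)) =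
      h (u i k * star (u j l)) • (1 : A) := by
    intro i j
    rw [← hinv, applySnd_of_comul_eq_sum (hΔ i j), Fintype.sum_prod_type]
  intro i p
  calc ∑ m, h (u m k * star (u p l)) • u i m
      = ∑ m, ∑ n, h (u m k * star (u n l)) • (u i m * ∑ j, star (u j n) * u j p) := by
        simp [huU.2]
    _ = ∑ j, (∑ m, ∑ n, h (u m k * star (u n l)) • (u i m * star (u j n))) * u j p := by
        simp only [Finset.mul_sum, Finset.smul_sum, Finset.sum_mul, smul_mul_assoc, mul_assoc]
        conv_rhs => rw [Finset.sum_comm]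
        exact Finset.sum_congr rfl fun _ _ => Finset.sum_comm
    _ = ∑ j, h (u i k * star (u j l)) • u j p := by
        simp only [hY, smul_mul_assoc, one_mul]

theorem exists_haar_orthogonality (hstar : ComulStar A) {h : A →ₗ[ℂ] ℂ}
    (hinv : ∀ a : A, applySnd h a = h a • (1 : A)) (hu : IsCorep u) (huU : IsUnitaryMatrix u)
    (huirr : IsIrreducibleCorep u) :
    ∃ F : Matrix (Fin d) (Fin d) ℂ,
      ∀ i j k l, h (u i k * star (u j l)) = if i = j then F k l else 0 := by
  choose F hF using fun k l => huirr _ (intertwines_haar hstar hinv hu huU k l)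
  refine ⟨F, fun i j k l => ?_⟩
  simpa [Matrix.one_apply] using congrFun (congrFun (hF k l) i) j

theorem IsCorep.linearIndependent [StarModule ℂ A] (hstar : ComulStar A) {h : A →ₗ[ℂ] ℂ}
    (hinv : ∀ a : A, applySnd h a = h a • (1 : A))
    (hfaith : ∀ a : A, h (star a * a) = 0 → a = 0) (hu : IsCorep u) (huU : IsUnitaryMatrix u)
    (huirr : IsIrreducibleCorep u) :
    LinearIndependent ℂ fun p : Fin d × Fin d => u p.1 p.2 := by
  obtain ⟨F, hF⟩ := exists_haar_orthogonality hstar hinv hu huU huirr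
  rw [Fintype.linearIndependent_iff]
  rintro a ha ⟨j, m⟩
  rw [Fintype.sum_prod_type] at ha
  have hFa : ∑ k, ∑ l, a (j, k) * (star (a (j, l)) * F k l) = 0 := by
    have key : h ((∑ i, ∑ k, a (i, k) • u i k) * star (∑ l, a (j, l) • u j l)) = 0 := by
      rw [ha, zero_mul, map_zero]
    simp only [star_sum, star_smul, Finset.sum_mul, Finset.mul_sum, smul_mul_assoc,
      mul_smul_comm, map_sum, map_smul, hF, smul_eq_mul] at key
    rw [Finset.sum_comm, Finset.sum_eq_single j] at key
    · rw [Finset.sum_comm]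
      simpa [mul_left_comm] using key
    · intro i _ hi
      simp [hi]
    · simp
  have hw : star (∑ l, a (j, l) • u m l) = 0 := by
    refine hfaith _ ?_
    rw [star_star, ← hFa]
    simp [Finset.sum_mul_sum, star_sum, star_smul, hF, mul_left_comm]
  have := congrArg (Coalgebra.counit (R := ℂ)) (star_eq_zero.mp hw)
  simpa [hu.2] using this

theorem LinearIndependent.star_family {ι A : Type*} [AddCommGroup A] [StarAddMonoid A]
    [Module ℂ A] [StarModule ℂ A] [Fintype ι] {v : ι → A} (hv : LinearIndependent ℂ v) :
    LinearIndependent ℂ fun i => star (v i) := by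
  rw [Fintype.linearIndependent_iff] at hv ⊢
  intro g hg i
  have := hv (fun i => star (g i)) (by simpa [star_sum, star_smul] using congrArg star hg) i
  simpa using this

end Orthogonality

/-- The commutant in `End ℂ C` of the algebra of left-slice maps `a ↦ (φ ⊗ id)(Δ a)` restricted
to `C` equals the algebra of restrictions of the right-slice maps `a ↦ (id ⊗ ψ)(Δ a)`, and is
isomorphic to the full matrix algebra `M_d(ℂ)`. -/
theorem commutant_eq_right_slices {A : Type*} [Ring A] [StarRing A] [HopfAlgebra ℂ A]
    [StarModule ℂ A] (hstar : ComulStar A)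
    (h : A →ₗ[ℂ] ℂ) (hh : IsHaarState h) (hfaith : ∀ a : A, h (star a * a) = 0 → a = 0)
    {d : ℕ} {u : Matrix (Fin d) (Fin d) A}
    (hu : IsCorep u) (huU : IsUnitaryMatrix u) (huirr : IsIrreducibleCorep u)
    (C : Submodule ℂ A)
    (hC : C = Submodule.span ℂ (Set.range fun p : Fin d × Fin d => star (u p.1 p.2)))
    (L R : Set (Module.End ℂ ↥C))
    (hL : L = {f : Module.End ℂ ↥C | ∃ φ : A →ₗ[ℂ] ℂ, ∀ x : ↥C, (↑(f x) : A) = applyFst φ ↑x})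
    (hR : R = {f : Module.End ℂ ↥C | ∃ ψ : A →ₗ[ℂ] ℂ, ∀ x : ↥C, (↑(f x) : A) = applySnd ψ ↑x}) :
    ((Subalgebra.centralizer ℂ L : Set (Module.End ℂ ↥C)) = R) ∧
      Nonempty (↥(Subalgebra.centralizer ℂ L) ≃ₐ[ℂ] Matrix (Fin d) (Fin d) ℂ) := by
  have hv : LinearIndependent ℂ fun p : Fin d × Fin d => star (u p.1 p.2) :=
    (hu.linearIndependent hstar hh.2.1 hfaith huU huirr).star_family
  subst hC
  have hΔ := hu.comul_star hstar
  have hb : ∀ p, (Module.Basis.span hv p : A) = star (u p.1 p.2) := fun p => by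
    rw [Module.Basis.span_apply]
  rw [setOf_restrict_applyFst (Module.Basis.span hv) hb hv hΔ] at hL
  rw [setOf_restrict_applySnd (Module.Basis.span hv) hb hv hΔ] at hR
  subst hL hR
  have hcent := centralizer_range_leftMatrixEnd (Module.Basis.span hv)
  refine ⟨by rw [hcent]; rfl, ⟨?_⟩⟩
  exact (Subalgebra.equivOfEq _ _ hcent).trans
    (AlgEquiv.ofInjective _ (rightMatrixEndHom_injective (Module.Basis.span hv))).symm
end

section
/- Let h be a faithful Haar state on A and let u ∈ M_d(A) be an irreducible unitary corepresentation. Equip A with the inner product ⟨a, b⟩ := h(star(b)·a) (which is positive definite since h is a faithful state). For k ∈ {1,…,d}, let C_k := span_ℂ{star(u_{ki}) : 1 ≤ i ≤ d}. Then each C_k has dimension exactly d, the subspaces C_1, …, C_d are pairwise orthogonal with respect to ⟨·,·⟩, and their direct sum equals C := span_ℂ{star(u_{ij}) : 1 ≤ i, j ≤ d}, which has dimension d². -/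
open scoped TensorProduct BigOperators ComplexOrder

/-- Averaging `uₗₐ * star uₖᵦ` with the Haar state gives a scalar matrix in `(l, k)`. -/
lemma exists_haar_mul_star_eq {A : Type*} [Ring A] [StarRing A] [Bialgebra ℂ A]
    (hstar : ComulStar A) {h : A →ₗ[ℂ] ℂ} (hinv : ∀ a : A, applySnd h a = h a • (1 : A))
    {d : ℕ} {u : Matrix (Fin d) (Fin d) A} (hu : IsCorep u) (huU : IsUnitaryMatrix u)
    (huirr : IsIrreducibleCorep u) (a b : Fin d) :
    ∃ c : ℂ, ∀ l k, h (u l a * star (u k b)) = if l = k then c else 0 := by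
  have key : ∀ l k, ∑ p, ∑ q, h (u p a * star (u q b)) • (u l p * star (u k q)) =
      h (u l a * star (u k b)) • (1 : A) := by
    intro l k
    rw [← hinv, applySnd, LinearMap.comp_apply, LinearMap.comp_apply, Bialgebra.comul_mul,
      hu.1, hstar (u k b) d _ _ (hu.1 k b), Finset.sum_mul_sum]
    simp [Algebra.TensorProduct.tmul_mul_tmul]
  obtain ⟨c, hc⟩ := huirr (Matrix.of fun l k => h (u l a * star (u k b))) (by
    intro i j
    simp only [Matrix.of_apply]
    have : ∑ k, h (u i a * star (u k b)) • u k j =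
        ∑ k, (∑ p, ∑ q, h (u p a * star (u q b)) • (u i p * star (u k q))) * u k j :=
      Finset.sum_congr rfl fun k _ => by rw [key, smul_mul_assoc, one_mul]
    rw [this]
    simp only [Finset.sum_mul, smul_mul_assoc, mul_assoc]
    rw [Finset.sum_comm]
    refine Finset.sum_congr rfl fun p _ => ?_
    rw [Finset.sum_comm]
    simp only [← Finset.smul_sum, ← Finset.mul_sum, huU.2]
    simp)
  refine ⟨c, fun l k => ?_⟩
  simpa [Matrix.one_apply] using congrFun (congrFun hc l) k

/-- Sesquilinear expansion of the Haar inner product of two combinations of row entries. -/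
lemma haar_star_mul_row_sum {A : Type*} [Ring A] [StarRing A] [Algebra ℂ A] [StarModule ℂ A]
    (h : A →ₗ[ℂ] ℂ) {d : ℕ} {u : Matrix (Fin d) (Fin d) A} {c : Fin d → Fin d → ℂ}
    (hc : ∀ a b l k, h (u l a * star (u k b)) = if l = k then c a b else 0)
    (k l : Fin d) (x y : Fin d → ℂ) :
    h (star (∑ j, y j • star (u l j)) * ∑ i, x i • star (u k i)) =
      if l = k then ∑ j, ∑ i, star (y j) * (x i * c j i) else 0 := by
  simp only [star_sum, star_smul, star_star, Finset.sum_mul_sum, smul_mul_assoc, mul_smul_comm,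
    map_sum, map_smul, hc, smul_eq_mul]
  split_ifs <;> simp [mul_left_comm]

/-- A combination of row entries that vanishes in one row has vanishing coefficients. -/
lemma coeff_eq_zero_of_row_sum_eq_zero {A : Type*} [Ring A] [StarRing A] [Bialgebra ℂ A]
    [StarModule ℂ A] {h : A →ₗ[ℂ] ℂ} (hfaith : ∀ a : A, h (star a * a) = 0 → a = 0)
    {d : ℕ} {u : Matrix (Fin d) (Fin d) A} (hu : IsCorep u) {c : Fin d → Fin d → ℂ}
    (hc : ∀ a b l k, h (u l a * star (u k b)) = if l = k then c a b else 0)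
    {k : Fin d} {x : Fin d → ℂ} (hx : ∑ i, x i • star (u k i) = 0) (l : Fin d) : x l = 0 := by
  have hk := haar_star_mul_row_sum h hc k k x x
  have hl := haar_star_mul_row_sum h hc l l x x
  rw [if_pos rfl] at hk hl
  rw [← hk, hx, mul_zero, map_zero] at hl
  have h0 := congrArg (fun a => Coalgebra.counit (R := ℂ) (star a)) (hfaith _ hl)
  simpa [star_sum, star_smul, hu.2] using h0

/-- The row spaces `C_k = span{star(u_{ki})}` of an irreducible unitary corepresentation each
have dimension `d`, are pairwise orthogonal for the inner product `⟨a,b⟩ = h(star(b)·a)`, and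
their direct sum is the full coefficient space `C`, of dimension `d²`. -/
theorem row_spaces_orthogonal_decomposition {A : Type*} [Ring A] [StarRing A] [HopfAlgebra ℂ A]
    [StarModule ℂ A] (hstar : ComulStar A)
    (h : A →ₗ[ℂ] ℂ) (hh : IsHaarState h) (hfaith : ∀ a : A, h (star a * a) = 0 → a = 0)
    {d : ℕ} {u : Matrix (Fin d) (Fin d) A}
    (hu : IsCorep u) (huU : IsUnitaryMatrix u) (huirr : IsIrreducibleCorep u)
    (C : Fin d → Submodule ℂ A)
    (hCk : ∀ k, C k = Submodule.span ℂ (Set.range fun i : Fin d => star (u k i)))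
    (Cfull : Submodule ℂ A)
    (hCfull : Cfull = Submodule.span ℂ (Set.range fun p : Fin d × Fin d => star (u p.1 p.2))) :
    (∀ k, Module.finrank ℂ ↥(C k) = d) ∧
      (∀ k l, k ≠ l → ∀ x ∈ C k, ∀ y ∈ C l, h (star y * x) = 0) ∧
      (⨆ k, C k) = Cfull ∧
      Module.finrank ℂ ↥Cfull = d ^ 2 := by
  choose c hc using exists_haar_mul_star_eq hstar hh.2.1 hu huU huirr
  have hrow : ∀ k, LinearIndependent ℂ fun i : Fin d => star (u k i) := fun k =>
    Fintype.linearIndependent_iff.2 fun _ hx => coeff_eq_zero_of_row_sum_eq_zero hfaith hu hc hx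
  have hall : LinearIndependent ℂ fun p : Fin d × Fin d => star (u p.1 p.2) := by
    refine Fintype.linearIndependent_iff.2 fun x hx => ?_
    rintro ⟨l, i⟩
    rw [Fintype.sum_prod_type] at hx
    refine coeff_eq_zero_of_row_sum_eq_zero (k := l) (x := fun i => x (l, i)) hfaith hu hc
      (hfaith _ ?_) i
    have h0 := congrArg
      (fun a => h (star (∑ j, x (l, j) • star (u l j)) * a)) hx
    beta_reduce at h0
    rw [Finset.mul_sum, map_sum, mul_zero, map_zero] at h0
    refine Eq.trans (Eq.symm ?_) h0
    refine Fintype.sum_eq_single l fun k hk => ?_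
    exact (haar_star_mul_row_sum h hc k l (fun i => x (k, i)) fun i => x (l, i)).trans
      (if_neg hk.symm)
  refine ⟨fun k => ?_, fun k l hkl x hx y hy => ?_, ?_, ?_⟩
  · rw [hCk, finrank_span_eq_card (hrow k), Fintype.card_fin]
  · rw [hCk, Submodule.mem_span_range_iff_exists_fun] at hx hy
    obtain ⟨x, rfl⟩ := hx
    obtain ⟨y, rfl⟩ := hy
    rw [haar_star_mul_row_sum h hc, if_neg hkl.symm]
  · simp only [hCk, hCfull]
    rw [← Submodule.span_iUnion]
    congr 1
    ext a
    simp
  · rw [hCfull, finrank_span_eq_card hall, Fintype.card_prod, Fintype.card_fin, sq]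
end
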